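/- Let P ⊆ E be a finite set of nonzero vectors, let R be a connected component of C \ ⋃_{μ ∈ P} H_{μ,2}, and fix x₀ ∈ R. Then the topological closure of R equals {x ∈ E : ⟨x, αᵢ⟩ ≥ 0 for all i, ⟨x, μ⟩ ≥ 2 for every μ ∈ P with ⟨x₀, μ⟩ > 2, and ⟨x, μ⟩ ≤ 2 for every μ ∈ P with ⟨x₀, μ⟩ < 2}. In particular, the closure of each region is an intersection of finitely many closed half-spaces, hence a closed convex polyhedron. -/

import Mathlib

open RealInnerProductSpace

section OpenPolyhedron

variable {E : Type*} [NormedAddCommGroup E] [InnerProductSpace ℝ E] {ι : Type*}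

/-- The open polyhedron cut out by the chamber inequalities and the strict inequalities
satisfied by `x₀` with respect to the affine hyperplanes `⟪x, μ⟫ = 2`, `μ ∈ P`. -/
def openPolyhedron (α : ι → E) (P : Finset E) (x₀ : E) : Set E :=
  {x | (∀ i, 0 < ⟪x, α i⟫) ∧ (∀ μ ∈ P, 2 < ⟪x₀, μ⟫ → 2 < ⟪x, μ⟫) ∧
    (∀ μ ∈ P, ⟪x₀, μ⟫ < 2 → ⟪x, μ⟫ < 2)}

/-- The polyhedron given by the weak versions of the inequalities in `openPolyhedron`. -/
def closedPolyhedron (α : ι → E) (P : Finset E) (x₀ : E) : Set E :=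
  {x | (∀ i, 0 ≤ ⟪x, α i⟫) ∧ (∀ μ ∈ P, 2 < ⟪x₀, μ⟫ → 2 ≤ ⟪x, μ⟫) ∧
    (∀ μ ∈ P, ⟪x₀, μ⟫ < 2 → ⟪x, μ⟫ ≤ 2)}

variable {α : ι → E} {P : Finset E} {x₀ : E}

theorem openPolyhedron_subset_closedPolyhedron :
    openPolyhedron α P x₀ ⊆ closedPolyhedron α P x₀ := fun _ hx ↦
  ⟨fun i ↦ (hx.1 i).le, fun μ hμ h ↦ (hx.2.1 μ hμ h).le, fun μ hμ h ↦ (hx.2.2 μ hμ h).le⟩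

theorem isClosed_closedPolyhedron : IsClosed (closedPolyhedron α P x₀) := by
  simp only [closedPolyhedron, Set.ofPred_and, Set.ofPred_forall]
  refine (isClosed_iInter fun i ↦ isClosed_le (by fun_prop) (by fun_prop)).inter
    (IsClosed.inter ?_ ?_) <;>
  exact isClosed_iInter fun μ ↦ isClosed_iInter fun _ ↦ isClosed_iInter fun _ ↦
    isClosed_le (by fun_prop) (by fun_prop)

theorem openSegment_subset_openPolyhedron (hx₀ : ∀ i, 0 < ⟪x₀, α i⟫) {x : E}
    (hx : x ∈ closedPolyhedron α P x₀) : openSegment ℝ x₀ x ⊆ openPolyhedron α P x₀ := by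
  rintro _ ⟨a, b, ha, hb, hab, rfl⟩
  refine ⟨fun i ↦ ?_, fun μ hμ h ↦ ?_, fun μ hμ h ↦ ?_⟩ <;>
    simp only [inner_add_left, real_inner_smul_left]
  · exact add_pos_of_pos_of_nonneg (mul_pos ha (hx₀ i)) (mul_nonneg hb.le (hx.1 i))
  · nlinarith [mul_lt_mul_of_pos_left h ha, mul_le_mul_of_nonneg_left (hx.2.1 μ hμ h) hb.le]
  · nlinarith [mul_lt_mul_of_pos_left h ha, mul_le_mul_of_nonneg_left (hx.2.2 μ hμ h) hb.le]

theorem closure_openPolyhedron (hx₀ : ∀ i, 0 < ⟪x₀, α i⟫) :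
    closure (openPolyhedron α P x₀) = closedPolyhedron α P x₀ := by
  refine (closure_minimal openPolyhedron_subset_closedPolyhedron
    isClosed_closedPolyhedron).antisymm fun x hx ↦ ?_
  apply closure_mono (openSegment_subset_openPolyhedron hx₀ hx)
  rw [closure_openSegment]
  exact right_mem_segment ℝ x₀ x

theorem isPreconnected_openPolyhedron (hx₀ : ∀ i, 0 < ⟪x₀, α i⟫) :
    IsPreconnected (openPolyhedron α P x₀) := by
  have hself : x₀ ∈ openPolyhedron α P x₀ := ⟨hx₀, fun _ _ h ↦ h, fun _ _ h ↦ h⟩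
  have hstar : StarConvex ℝ x₀ (openPolyhedron α P x₀) :=
    (starConvex_iff_openSegment_subset hself).2 fun _ hx ↦
      openSegment_subset_openPolyhedron hx₀ (openPolyhedron_subset_closedPolyhedron hx)
  exact (hstar.isPathConnected hself).isConnected.isPreconnected

theorem connectedComponentIn_eq_openPolyhedron
    (hx₀ : x₀ ∈ {x : E | ∀ i, 0 < ⟪x, α i⟫} \ ⋃ μ ∈ P, {x : E | ⟪x, μ⟫ = 2}) :
    connectedComponentIn ({x : E | ∀ i, 0 < ⟪x, α i⟫} \ ⋃ μ ∈ P, {x : E | ⟪x, μ⟫ = 2}) x₀ =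
      openPolyhedron α P x₀ := by
  set S := {x : E | ∀ i, 0 < ⟪x, α i⟫} \ ⋃ μ ∈ P, {x : E | ⟪x, μ⟫ = 2}
  have hne : ∀ {x}, x ∈ S → ∀ μ ∈ P, ⟪x, μ⟫ ≠ 2 := fun hx μ hμ h ↦
    hx.2 (Set.mem_biUnion hμ h)
  have hsub := connectedComponentIn_subset S x₀
  have hmem := mem_connectedComponentIn hx₀
  have hconn (μ : E) : ((fun x ↦ ⟪x, μ⟫) '' connectedComponentIn S x₀).OrdConnected :=
    (isPreconnected_connectedComponentIn.image _
      (Continuous.continuousOn (by fun_prop))).ordConnected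
  apply Set.Subset.antisymm
  · refine fun x hx ↦ ⟨(hsub hx).1, fun μ hμ h ↦ ?_, fun μ hμ h ↦ ?_⟩ <;> by_contra! hle
    · obtain ⟨y, hy, hy2⟩ := (hconn μ).out ⟨x, hx, rfl⟩ ⟨x₀, hmem, rfl⟩ ⟨hle, h.le⟩
      exact hne (hsub hy) μ hμ hy2
    · obtain ⟨y, hy, hy2⟩ := (hconn μ).out ⟨x₀, hmem, rfl⟩ ⟨x, hx, rfl⟩ ⟨h.le, hle⟩
      exact hne (hsub hy) μ hμ hy2
  · refine (isPreconnected_openPolyhedron hx₀.1).subset_connectedComponentIn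
      ⟨hx₀.1, fun _ _ h ↦ h, fun _ _ h ↦ h⟩ fun x hx ↦ ⟨hx.1, fun hx' ↦ ?_⟩
    obtain ⟨μ, hμ, h2 : ⟪x, μ⟫ = 2⟩ := Set.mem_iUnion₂.1 hx'
    rcases lt_or_gt_of_ne (hne hx₀ μ hμ) with h | h
    · exact (hx.2.2 μ hμ h).ne h2
    · exact (hx.2.1 μ hμ h).ne' h2

end OpenPolyhedron

/-- Let `P` be a finite set of nonzero vectors, `R` a connected component (region) of
`C \ ⋃_{μ ∈ P} H_{μ,2}` and `x₀ ∈ R`. Then the topological closure of `R` equals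
`{x | ∀ i, ⟪x, αᵢ⟫ ≥ 0, and ⟪x, μ⟫ ≥ 2 whenever μ ∈ P with ⟪x₀, μ⟫ > 2, and
⟪x, μ⟫ ≤ 2 whenever μ ∈ P with ⟪x₀, μ⟫ < 2}`; in particular the closure of each region
is a finite intersection of closed half-spaces, hence a closed convex polyhedron. -/
theorem closure_region_eq_polyhedron {E : Type*} [NormedAddCommGroup E]
    [InnerProductSpace ℝ E] [FiniteDimensional ℝ E] {p : ℕ}
    (α : Fin p → E) (hα : LinearIndependent ℝ α)
    (P : Finset E) (hP : ∀ μ ∈ P, μ ≠ (0 : E))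
    (S : Set E)
    (hS : S = {x : E | ∀ i, 0 < ⟪x, α i⟫} \ ⋃ μ ∈ P, {x : E | ⟪x, μ⟫ = 2})
    (R : Set E) (x₀ : E) (hx₀ : x₀ ∈ S) (hR : R = connectedComponentIn S x₀) :
    closure R = {x : E | (∀ i, 0 ≤ ⟪x, α i⟫) ∧
      (∀ μ ∈ P, 2 < ⟪x₀, μ⟫ → 2 ≤ ⟪x, μ⟫) ∧
      (∀ μ ∈ P, ⟪x₀, μ⟫ < 2 → ⟪x, μ⟫ ≤ 2)} := by
  subst hS hR
  rw [connectedComponentIn_eq_openPolyhedron hx₀]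
  exact closure_openPolyhedron hx₀.1
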